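/- arXiv:2512.18705 — 4 statements merged into one kernel-verified Lean document; each statement's English description precedes it below -/
import Mathlib

section
/- Twisted basic inequality: let (β̂, σ̂) be any minimizer of β, σ ↦ exp[R_n(β,σ)] + λ‖β‖₁ over ℝ^p × (0,∞), and set b̂ := (β̂ − β*)/σ̂, d̂ := σ*/σ̂. Then for every t ∈ [0,1], writing b̂_t := t b̂ and d̂_t := t d̂ + (1 − t), one has e^{P_n g_{0,1}} · { P_n(g_{b̂_t, d̂_t} − g_{0,1}) + 1 − d̂_t } ≤ λ ( ‖(b̂_t)_{S*}‖₁ − ‖(b̂_t)_{−S*}‖₁ ). -/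
open scoped BigOperators Classical

/-- Moving from `a` to `c` lowers the `ℓ¹` norm by at most
the mass of `c - a` on the support of `a` minus its mass
off that support. -/
theorem l1_sub_l1_le_support_sub_compl {ι : Type*} [Fintype ι] (a c : ι → ℝ) :
    ∑ j, |a j| - ∑ j, |c j| ≤
      (∑ j, if a j ≠ 0 then |c j - a j| else 0) - ∑ j, if a j ≠ 0 then 0 else |c j - a j| := by
  rw [← Finset.sum_sub_distrib, ← Finset.sum_sub_distrib]
  refine Finset.sum_le_sum fun j _ => ?_
  by_cases h : a j = 0
  · simp [h]
  · have := abs_sub_abs_le_abs_sub (a j) (c j)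
    rw [abs_sub_comm] at this
    simpa [h] using this

/-- **Twisted basic inequality** (Theorem `twisted` of the paper).  In the linear model
`y_i = x_i β* + σ* ξ_i` with `l := −log f` convex and differentiable, let `(β̂, σ̂)` be any
minimizer of `exp[R_n(β,σ)] + λ‖β‖₁` over `ℝ^p × (0,∞)`, and set `b̂ := (β̂ − β*)/σ̂`,
`d̂ := σ*/σ̂`.  Then for every `t ∈ [0,1]`, with `b̂_t := t b̂` and `d̂_t := t d̂ + (1−t)`,
`e^{P_n g_{0,1}} { P_n(g_{b̂_t,d̂_t} − g_{0,1}) + 1 − d̂_t }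
  ≤ λ(‖(b̂_t)_{S*}‖₁ − ‖(b̂_t)_{−S*}‖₁)`,
where `g_{b,d}(x,ξ) := l(dξ − xb)`, `P_n h := (1/n)Σ_i h(x_i, ξ_i)` and `S* := {j : β*_j ≠ 0}`. -/
theorem twisted_basic_inequality
    (f : ℝ → ℝ) (hf : ∀ y, 0 < f y)
    (l : ℝ → ℝ) (hl : l = fun t => - Real.log (f t))
    (hconv : ConvexOn ℝ Set.univ l) (hdiff : Differentiable ℝ l)
    (n p : ℕ) (hn : 0 < n)
    (x : Fin n → Fin p → ℝ) (βstar : Fin p → ℝ) (σstar : ℝ) (hσstar : 0 < σstar)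
    (ξ : Fin n → ℝ) (y : Fin n → ℝ)
    (hy : ∀ i, y i = (∑ j, x i j * βstar j) + σstar * ξ i)
    (lam : ℝ) (hlam : 0 < lam)
    (Rn : (Fin p → ℝ) → ℝ → ℝ)
    (hRn : ∀ β σ, Rn β σ =
      (1 / (n : ℝ)) * ∑ i, (l ((y i - ∑ j, x i j * β j) / σ) + Real.log σ))
    (βhat : Fin p → ℝ) (σhat : ℝ) (hσhat : 0 < σhat)
    (hargmin : ∀ (β : Fin p → ℝ) (σ : ℝ), 0 < σ →
      Real.exp (Rn βhat σhat) + lam * ∑ j, |βhat j| ≤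
        Real.exp (Rn β σ) + lam * ∑ j, |β j|)
    -- the empirical measure applied to `g_{b,d}`:
    (Pn : (Fin p → ℝ) → ℝ → ℝ)
    (hPn : ∀ b d, Pn b d = (1 / (n : ℝ)) * ∑ i, l (d * ξ i - ∑ j, x i j * b j)) :
    ∀ t : ℝ, 0 ≤ t → t ≤ 1 →
      Real.exp (Pn 0 1) *
          (Pn (fun j => t * ((βhat j - βstar j) / σhat)) (t * (σstar / σhat) + (1 - t))
            - Pn 0 1 + 1 - (t * (σstar / σhat) + (1 - t))) ≤
        lam * ((∑ j, if βstar j ≠ 0 then |t * ((βhat j - βstar j) / σhat)| else 0)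
          - ∑ j, if βstar j ≠ 0 then 0 else |t * ((βhat j - βstar j) / σhat)|) := by
  intro t ht0 ht1
  have hn' : (0 : ℝ) < n := Nat.cast_pos.mpr hn
  set b : Fin p → ℝ := fun j => (βhat j - βstar j) / σhat with hb
  set d : ℝ := σstar / σhat with hd
  have hRn_Pn_hat : Rn βhat σhat = Pn b d + Real.log σhat := by
    rw [hRn, hPn, Finset.sum_add_distrib, mul_add]
    congr 1
    · congr 1
      refine Finset.sum_congr rfl fun i _ => ?_
      congr 1
      simp only [hb, hd, hy, mul_div_assoc', ← Finset.sum_div, mul_sub, Finset.sum_sub_distrib]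
      field_simp
      ring
    · simp [hn'.ne']
  have hRn_Pn_star : Rn βstar σstar = Pn 0 1 + Real.log σstar := by
    rw [hRn, hPn, Finset.sum_add_distrib, mul_add]
    congr 1
    · congr 1
      refine Finset.sum_congr rfl fun i _ => ?_
      congr 1
      simp [hy, hσstar.ne']
    · simp [hn'.ne']
  have hPn_convex : Pn (fun j => t * b j) (t * d + (1 - t)) ≤ t * Pn b d + (1 - t) * Pn 0 1 := by
    rw [hPn, hPn, hPn, mul_left_comm t, mul_left_comm (1 - t), ← mul_add, Finset.mul_sum _ _ t,
      Finset.mul_sum _ _ (1 - t), ← Finset.sum_add_distrib]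
    refine mul_le_mul_of_nonneg_left (Finset.sum_le_sum fun i _ => ?_) (by positivity)
    have h := hconv.2 (Set.mem_univ (d * ξ i - ∑ j, x i j * b j)) (Set.mem_univ (ξ i)) ht0
      (sub_nonneg.mpr ht1) (by ring)
    simp only [smul_eq_mul] at h
    convert h using 2
    · simp only [mul_left_comm _ t, ← Finset.mul_sum]
      ring
    · simp
  have hbasic : Real.exp (Pn b d) - Real.exp (Pn 0 1) * d ≤
      lam * ((∑ j, if βstar j ≠ 0 then |b j| else 0)
        - ∑ j, if βstar j ≠ 0 then 0 else |b j|) := by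
    have hmin := hargmin βstar σstar hσstar
    rw [hRn_Pn_hat, hRn_Pn_star, Real.exp_add, Real.exp_add, Real.exp_log hσhat,
      Real.exp_log hσstar] at hmin
    have hl1 := mul_le_mul_of_nonneg_left (l1_sub_l1_le_support_sub_compl βstar βhat) hlam.le
    have hscale (j : Fin p) : |b j| = |βhat j - βstar j| / σhat := by
      rw [hb, abs_div, abs_of_pos hσhat]
    have hS : (∑ j, if βstar j ≠ 0 then |b j| else 0) =
        (∑ j, if βstar j ≠ 0 then |βhat j - βstar j| else 0) / σhat := by
      simp only [hscale, Finset.sum_div, ite_div, zero_div]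
    have hSc : (∑ j, if βstar j ≠ 0 then 0 else |b j|) =
        (∑ j, if βstar j ≠ 0 then 0 else |βhat j - βstar j|) / σhat := by
      simp only [hscale, Finset.sum_div, ite_div, zero_div]
    rw [hS, hSc, ← sub_div, ← mul_div_assoc lam, le_div_iff₀ hσhat, sub_mul, mul_assoc, hd,
      div_mul_cancel₀ _ hσhat.ne']
    linarith
  have htangent : Real.exp (Pn 0 1) * (Pn b d - Pn 0 1 + 1) ≤ Real.exp (Pn b d) := by
    calc Real.exp (Pn 0 1) * (Pn b d - Pn 0 1 + 1)
        ≤ Real.exp (Pn 0 1) * Real.exp (Pn b d - Pn 0 1) :=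
          mul_le_mul_of_nonneg_left (Real.add_one_le_exp _) (Real.exp_pos _).le
      _ = Real.exp (Pn b d) := by rw [← Real.exp_add, add_sub_cancel]
  have hrhs : lam * ((∑ j, if βstar j ≠ 0 then |t * b j| else 0)
        - ∑ j, if βstar j ≠ 0 then 0 else |t * b j|) =
      t * (lam * ((∑ j, if βstar j ≠ 0 then |b j| else 0)
        - ∑ j, if βstar j ≠ 0 then 0 else |b j|)) := by
    rw [mul_left_comm, mul_sub t, Finset.mul_sum, Finset.mul_sum]
    simp only [abs_mul, abs_of_nonneg ht0, mul_ite, mul_zero]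
  change _ ≤ lam * ((∑ j, if βstar j ≠ 0 then |t * b j| else 0)
    - ∑ j, if βstar j ≠ 0 then 0 else |t * b j|)
  rw [hrhs]
  calc Real.exp (Pn 0 1) * (Pn (fun j => t * b j) (t * d + (1 - t)) - Pn 0 1 + 1
          - (t * d + (1 - t)))
      ≤ Real.exp (Pn 0 1) * (t * (Pn b d - Pn 0 1 + 1 - d)) :=
        mul_le_mul_of_nonneg_left (by linarith) (Real.exp_pos _).le
    _ = t * (Real.exp (Pn 0 1) * (Pn b d - Pn 0 1 + 1) - Real.exp (Pn 0 1) * d) := by ring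
    _ ≤ _ := mul_le_mul_of_nonneg_left (by linarith) ht0
end

section
/- Disappearance act (pivotality identity): let f be a positive density on ℝ with l := −log f, let x_1,…,x_n ∈ ℝ^p be row vectors, y_i = x_i β* + σ* ξ_i with β* ∈ ℝ^p, σ* > 0 and ξ_i ∈ ℝ. Then for every β ∈ ℝ^p and σ > 0, setting b := (β − β*)/σ and d := σ*/σ, one has exp[R_n(β,σ)] + λ‖β‖₁ = σ* · ( exp[ (1/n)Σ_i l(d ξ_i − x_i b) − log d ] + λ ‖ β*/σ* + b/d ‖₁ ), where R_n(β,σ) := (1/n)Σ_i [ l((y_i − x_i β)/σ) + log σ ]. In particular the minimization of exp[R_n(β,σ)] + λ‖β‖₁ over (β,σ), expressed in the parameters (b,d), does not depend on σ*. -/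
open scoped BigOperators

/-- **Disappearance act (pivotality identity).**  Let `f` be a positive density on `ℝ` with
`l := −log f`, let `x 1, …, x n ∈ ℝ^p` be row vectors, `y i = x i β* + σ* ξ i`.  Then for every
`β ∈ ℝ^p` and `σ > 0`, setting `b := (β − β*)/σ` and `d := σ*/σ`,
`exp[R_n(β,σ)] + λ‖β‖₁ = σ* ( exp[ (1/n)Σ_i l(d ξ_i − x_i b) − log d ] + λ ‖β*/σ* + b/d‖₁ )`,
where `R_n(β,σ) := (1/n)Σ_i [ l((y_i − x_i β)/σ) + log σ ]`.  In particular the minimization,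
expressed in the parameters `(b,d)`, does not depend on `σ*`. -/
theorem disappearance_act
    (f : ℝ → ℝ) (hf : ∀ y, 0 < f y)
    (n p : ℕ) (hn : 0 < n)
    (x : Fin n → Fin p → ℝ) (βstar : Fin p → ℝ) (σstar : ℝ) (hσstar : 0 < σstar)
    (ξ : Fin n → ℝ) (y : Fin n → ℝ)
    (hy : ∀ i, y i = (∑ j, x i j * βstar j) + σstar * ξ i)
    (lam : ℝ)
    (l : ℝ → ℝ) (hl : l = fun t => - Real.log (f t))
    (Rn : (Fin p → ℝ) → ℝ → ℝ)
    (hRn : ∀ β σ, Rn β σ =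
      (1 / (n : ℝ)) * ∑ i, (l ((y i - ∑ j, x i j * β j) / σ) + Real.log σ)) :
    ∀ (β : Fin p → ℝ) (σ : ℝ), 0 < σ →
      Real.exp (Rn β σ) + lam * ∑ j, |β j| =
        σstar *
          (Real.exp ((1 / (n : ℝ)) *
              (∑ i, l ((σstar / σ) * ξ i - ∑ j, x i j * ((β j - βstar j) / σ)))
              - Real.log (σstar / σ))
            + lam * ∑ j, |βstar j / σstar + ((β j - βstar j) / σ) / (σstar / σ)|) := by
  intro β σ hσ
  have hn' : (n : ℝ) ≠ 0 := by exact_mod_cast hn.ne'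
  have residual (i : Fin n) : (y i - ∑ j, x i j * β j) / σ =
      (σstar / σ) * ξ i - ∑ j, x i j * ((β j - βstar j) / σ) := by
    have hsum : ∑ j, x i j * ((β j - βstar j) / σ) =
        (∑ j, x i j * β j - ∑ j, x i j * βstar j) / σ := by
      rw [← Finset.sum_sub_distrib, Finset.sum_div]
      exact Finset.sum_congr rfl fun j _ => by ring
    rw [hsum, hy]
    ring
  have coord (j : Fin p) :
      |βstar j / σstar + ((β j - βstar j) / σ) / (σstar / σ)| = |β j| / σstar := by
    rw [← abs_of_pos hσstar, ← abs_div, abs_of_pos hσstar]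
    congr 1
    field_simp
    ring
  have risk : Rn β σ = (1 / (n : ℝ)) *
      (∑ i, l ((σstar / σ) * ξ i - ∑ j, x i j * ((β j - βstar j) / σ))) + Real.log σ := by
    rw [hRn, Finset.sum_add_distrib, Finset.sum_const, Finset.card_univ, Fintype.card_fin,
      nsmul_eq_mul, Finset.sum_congr rfl fun i _ => by rw [residual i]]
    field_simp
  simp only [coord]
  rw [risk, Real.exp_add, Real.exp_log hσ, Real.exp_sub, Real.exp_log (div_pos hσstar hσ),
    ← Finset.sum_div]
  field_simp
end

section
/- Exp-Lasso equals square-root Lasso for Gaussian noise: let f be the standard normal density, so that l(y) = y²/2 + (1/2)log(2π), and R_n(β,σ) := (1/n)Σ_{i=1}^n [ (y_i − x_iβ)²/(2σ²) + log σ + (1/2)log(2π) ]. Then for every β ∈ ℝ^p, inf_{σ > 0} exp[ R_n(β,σ) ] = e^{(1 + log(2π))/2} · ( (1/n) Σ_{i=1}^n (y_i − x_i β)² )^{1/2}. Consequently, minimizing exp[R_n(β,σ)] + λ‖β‖₁ over (β, σ) is the square-root Lasso problem min_β e^{(1+log(2π))/2} ( Σ_i (y_i − x_iβ)²/n )^{1/2}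 + λ‖β‖₁. -/
open scoped BigOperators

/-- The profile over the scale `σ` of the exponentiated Gaussian negative log-likelihood. -/
lemma isGLB_range_exp_div_add_log (c : ℝ) {Q : ℝ} (hQ : 0 ≤ Q) :
    IsGLB (Set.range fun σ : Set.Ioi (0 : ℝ) =>
        Real.exp (Q / (2 * (σ : ℝ) ^ 2) + Real.log σ + c))
      (Real.exp (1 / 2 + c) * Real.sqrt Q) := by
  rcases hQ.eq_or_lt with rfl | hQ
  · have h_exp (σ : Set.Ioi (0 : ℝ)) :
        Real.exp (0 / (2 * (σ : ℝ) ^ 2) + Real.log σ + c) = σ * Real.exp c := by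
      rw [zero_div, zero_add, Real.exp_add, Real.exp_log σ.2]
    simp only [h_exp, Real.sqrt_zero, mul_zero]
    refine ⟨?_, fun b hb => ?_⟩
    · rintro _ ⟨σ, rfl⟩
      exact mul_nonneg (le_of_lt σ.2) (Real.exp_pos c).le
    · by_contra! hb_pos
      have hσ : 0 < b / 2 / Real.exp c := by positivity
      have h := hb ⟨⟨_, hσ⟩, rfl⟩
      simp only [div_mul_cancel₀ _ (Real.exp_pos c).ne'] at h
      linarith
  · have h_sqrt : 0 < Real.sqrt Q := Real.sqrt_pos.2 hQ
    have h_min : Real.exp (1 / 2 + c) * Real.sqrt Q =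
        Real.exp (1 / 2 + Real.log (Real.sqrt Q) + c) := by
      rw [add_right_comm, Real.exp_add (1 / 2 + c), Real.exp_log h_sqrt]
    rw [h_min]
    refine IsLeast.isGLB ⟨⟨⟨Real.sqrt Q, h_sqrt⟩, ?_⟩, ?_⟩
    · have h_half : Q / (2 * Real.sqrt Q ^ 2) = 1 / 2 := by
        rw [Real.sq_sqrt hQ.le]
        field_simp
      simp only [h_half]
    · rintro _ ⟨⟨σ, hσ⟩, rfl⟩
      have hσ : 0 < σ := hσ
      have h := Real.log_le_sub_one_of_pos (show 0 < Q / σ ^ 2 by positivity)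
      rw [Real.log_div hQ.ne' (by positivity), Real.log_pow] at h
      have h_div : Q / (2 * σ ^ 2) = Q / σ ^ 2 / 2 := by
        field_simp
      refine Real.exp_le_exp.2 ?_
      simp only [Real.log_sqrt hQ.le, h_div]
      push_cast at h
      linarith

/-- **Exp-Lasso equals square-root Lasso for Gaussian noise.**  With
`R_n(β,σ) := (1/n)Σ_i [ (y_i − x_iβ)²/(2σ²) + log σ + (1/2)log(2π) ]` (minus-log-likelihood of
the standard normal density), for every `β ∈ ℝ^p`,
`inf_{σ > 0} exp[R_n(β,σ)] = e^{(1+log(2π))/2} √((1/n)Σ_i (y_i − x_iβ)²)`, and consequently the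
`σ`-profiled penalized objective is the square-root Lasso objective. -/
theorem expLasso_eq_sqrtLasso_gaussian
    (n p : ℕ) (hn : 0 < n)
    (x : Fin n → Fin p → ℝ) (y : Fin n → ℝ) (lam : ℝ)
    (Rn : (Fin p → ℝ) → ℝ → ℝ)
    (hRn : ∀ β σ, Rn β σ =
      (1 / (n : ℝ)) * ∑ i, ((y i - ∑ j, x i j * β j) ^ 2 / (2 * σ ^ 2)
        + Real.log σ + (1 / 2) * Real.log (2 * Real.pi))) :
    ∀ β : Fin p → ℝ,
      (⨅ σ : Set.Ioi (0 : ℝ), Real.exp (Rn β (σ : ℝ))) =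
        Real.exp ((1 + Real.log (2 * Real.pi)) / 2) *
          Real.sqrt ((1 / (n : ℝ)) * ∑ i, (y i - ∑ j, x i j * β j) ^ 2) ∧
      (⨅ σ : Set.Ioi (0 : ℝ), (Real.exp (Rn β (σ : ℝ)) + lam * ∑ j, |β j|)) =
        Real.exp ((1 + Real.log (2 * Real.pi)) / 2) *
          Real.sqrt ((1 / (n : ℝ)) * ∑ i, (y i - ∑ j, x i j * β j) ^ 2)
          + lam * ∑ j, |β j| := by
  intro β
  set Q : ℝ := (1 / (n : ℝ)) * ∑ i, (y i - ∑ j, x i j * β j) ^ 2 with hQ_def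
  have hQ : 0 ≤ Q := by positivity
  have hn' : (n : ℝ) ≠ 0 := by positivity
  have hR (σ : ℝ) :
      Rn β σ = Q / (2 * σ ^ 2) + Real.log σ + 1 / 2 * Real.log (2 * Real.pi) := by
    rw [hRn, Finset.sum_add_distrib, Finset.sum_add_distrib, ← Finset.sum_div, hQ_def]
    simp only [Finset.sum_const, Finset.card_univ, Fintype.card_fin, nsmul_eq_mul]
    rw [mul_add, mul_add, ← mul_assoc (1 / (n : ℝ)) n, ← mul_assoc (1 / (n : ℝ)) n,
      one_div_mul_cancel hn', one_mul, one_mul, mul_div_assoc]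
  have h_glb := isGLB_range_exp_div_add_log (1 / 2 * Real.log (2 * Real.pi)) hQ
  have h_const : (1 + Real.log (2 * Real.pi)) / 2 = 1 / 2 + 1 / 2 * Real.log (2 * Real.pi) := by
    ring
  have : Nonempty (Set.Ioi (0 : ℝ)) := ⟨⟨1, Set.mem_Ioi.2 one_pos⟩⟩
  simp only [hR, h_const]
  refine ⟨h_glb.ciInf_eq, ?_⟩
  rw [← ciInf_add h_glb.bddBelow, h_glb.ciInf_eq]
end

section
/- Misspecification bound on the cross-entropy: let l : ℝ → ℝ be convex and differentiable, attaining its minimum at some point y₀ ∈ ℝ, and let ξ be a real random variable with E|l(ξ)| < ∞, E|l̇(ξ)| < ∞, E|l̇(ξ)ξ| < ∞ satisfying the normalization E l̇(ξ) = 0 and E l̇(ξ)ξ = 1. Then E l(ξ) ≤ min_y l(y) + 1. -/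
open MeasureTheory

/-- A convex function lies above each of its tangent lines. -/
theorem ConvexOn.add_deriv_mul_sub_le {S : Set ℝ} {f : ℝ → ℝ} {x y : ℝ} (hf : ConvexOn ℝ S f)
    (hx : x ∈ S) (hy : y ∈ S) (hd : DifferentiableAt ℝ f x) :
    f x + deriv f x * (y - x) ≤ f y := by
  rcases lt_trichotomy x y with h | rfl | h
  · have := hf.deriv_le_slope hx hy h hd
    rw [slope_def_field, le_div_iff₀ (sub_pos.2 h)] at this
    linarith
  · simp
  · have := hf.slope_le_deriv hy hx h hd
    rw [slope_def_field, div_le_iff₀ (sub_pos.2 h)] at this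
    linarith

/-- **Misspecification bound on the cross-entropy.**  Let `l : ℝ → ℝ` be convex and
differentiable, attaining its minimum at some `y₀`, and let `ξ` be a real random variable with
`E|l(ξ)| < ∞`, `E|l̇(ξ)| < ∞`, `E|l̇(ξ)ξ| < ∞`, normalized so that `E l̇(ξ) = 0` and
`E l̇(ξ)ξ = 1`.  Then `E l(ξ) ≤ min_y l(y) + 1`. -/
theorem cross_entropy_bound
    {Ω : Type*} [MeasureSpace Ω] [IsProbabilityMeasure (volume : Measure Ω)]
    (l : ℝ → ℝ) (hconv : ConvexOn ℝ Set.univ l) (hdiff : Differentiable ℝ l)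
    (y₀ : ℝ) (hmin : ∀ y, l y₀ ≤ l y)
    (ξ : Ω → ℝ) (hξ : Measurable ξ)
    (hint1 : Integrable (fun ω => l (ξ ω)))
    (hint2 : Integrable (fun ω => deriv l (ξ ω)))
    (hint3 : Integrable (fun ω => deriv l (ξ ω) * ξ ω))
    (hnorm1 : ∫ ω, deriv l (ξ ω) = 0)
    (hnorm2 : ∫ ω, deriv l (ξ ω) * ξ ω = 1) :
    ∫ ω, l (ξ ω) ≤ l y₀ + 1 := by
  have hle : ∀ ω, l (ξ ω) ≤ l y₀ + deriv l (ξ ω) * ξ ω - y₀ * deriv l (ξ ω) := fun ω => by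
    linarith [hconv.add_deriv_mul_sub_le (Set.mem_univ (ξ ω)) (Set.mem_univ y₀) (hdiff (ξ ω))]
  have hint : Integrable (fun ω => l y₀ + deriv l (ξ ω) * ξ ω) := (integrable_const _).add hint3
  calc ∫ ω, l (ξ ω)
      ≤ ∫ ω, (l y₀ + deriv l (ξ ω) * ξ ω - y₀ * deriv l (ξ ω)) :=
        integral_mono hint1 (hint.sub (hint2.const_mul y₀)) hle
    _ = l y₀ + 1 := by
        rw [integral_sub hint (hint2.const_mul y₀), integral_add (integrable_const _) hint3,
          integral_const_mul, hnorm1, hnorm2]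
        simp
end
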